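/- Let N₁, N₂ be commuting von Neumann subalgebras of a von Neumann algebra N acting on a Hilbert space H, and let φ be a normal state on N that is not a product state across N₁ and N₂ (i.e., there exist X ∈ N₁, Y ∈ N₂ with φ(XY) ≠ φ(X)φ(Y)). Then there exist projections A ∈ N₁ and B ∈ N₂ such that φ(AB) > φ(A)φ(B). -/

import Mathlib

open scoped ComplexOrder

section ProjectionsInVonNeumannAlgebra

variable {H : Type*} [NormedAddCommGroup H] [InnerProductSpace ℂ H] [CompleteSpace H]

namespace VonNeumannAlgebra

theorem smul_mem (N : VonNeumannAlgebra H) (c : ℂ) {T : H →L[ℂ] H} (hT : T ∈ N) : c • T ∈ N :=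
  N.toStarSubalgebra.smul_mem hT c

theorem real_smul_mem (N : VonNeumannAlgebra H) (c : ℝ) {T : H →L[ℂ] H} (hT : T ∈ N) :
    c • T ∈ N := by
  rw [← Complex.coe_smul]
  exact N.smul_mem c hT

theorem cfc_real_mem (N : VonNeumannAlgebra H) {T : H →L[ℂ] H} (hT : T ∈ N) (f : ℝ → ℝ) :
    cfc f T ∈ N := by
  rw [← N.commutant_commutant, mem_commutant_iff]
  intro y hy
  have h : Commute T y := mem_commutant_iff.mp hy T hT
  exact (h.cfc_real f).symm.eq

theorem starProjection_ker_mem (N : VonNeumannAlgebra H) {T : H →L[ℂ] H} (hT : T ∈ N) :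
    (T.ker).starProjection ∈ N := by
  rw [IsStarProjection.mem_iff isStarProjection_starProjection]
  intro y hy
  rw [Submodule.range_starProjection]
  intro x hx
  have h : T * y = y * T := mem_commutant_iff.mp hy T hT
  have hx' : T x = 0 := hx
  change T (y x) = 0
  simpa [hx'] using congr($h x)

/-- A self-adjoint element of norm at most `r` is within `r / 2` of a multiple of a symmetry. -/
theorem exists_isStarProjection_norm_sub_le (N : VonNeumannAlgebra H) {T : H →L[ℂ] H}
    (hT : T ∈ N) (hsa : IsSelfAdjoint T) {r : ℝ} (hr : ‖T‖ ≤ r) :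
    ∃ P ∈ N, IsStarProjection P ∧ ‖T - (r / 2) • (1 - 2 * P)‖ ≤ r / 2 := by
  have hr0 : 0 ≤ r := (norm_nonneg T).trans hr
  set F : H →L[ℂ] H := cfc (fun x : ℝ ↦ max x 0) T with hF
  set G : H →L[ℂ] H := cfc (fun x : ℝ ↦ max (-x) 0) T with hG
  set P : H →L[ℂ] H := F.ker.starProjection with hPdef
  have hPN : P ∈ N := N.starProjection_ker_mem (N.cfc_real_mem hT _)
  have hP : IsStarProjection P := isStarProjection_starProjection
  have hFsa : star F = F := (cfc_predicate (p := IsSelfAdjoint) _ T : IsSelfAdjoint F)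
  have hFP : F * P = 0 := by
    ext x
    exact F.ker.starProjection_apply_mem x
  have hPF : P * F = 0 := by
    simpa [hFsa, hP.isSelfAdjoint.star_eq] using congr(star $hFP)
  have hFG : F * G = 0 := by
    rw [hF, hG, ← cfc_mul .., ← cfc_zero ℝ T]
    congr 1
    ext x
    rcases le_total x 0 with h | h <;> simp [h]
  have hPG : P * G = G := by
    ext x
    exact Submodule.starProjection_eq_self_iff.mpr congr($hFG x)
  have hT_eq : T = F - G := by
    rw [hF, hG, ← cfc_sub ..]
    conv_lhs => rw [← cfc_id ℝ T]
    congr 1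
    ext x
    rcases le_total x 0 with h | h <;> simp [h]
  have habs : ‖F + G - (r / 2) • (1 : H →L[ℂ] H)‖ ≤ r / 2 := by
    rw [← Algebra.algebraMap_eq_smul_one, hF, hG, ← cfc_add .., ← cfc_const (r / 2) T,
      ← cfc_sub ..]
    refine norm_cfc_le (by positivity) fun x hx ↦ ?_
    have hx' : |x| ≤ r := by
      rcases subsingleton_or_nontrivial (H →L[ℂ] H) with _ | _
      · simp [spectrum.of_subsingleton] at hx
      · exact (spectrum.norm_le_norm_of_mem hx).trans hr
    rw [Real.norm_eq_abs, abs_le]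
    rw [abs_le] at hx'
    rcases le_total x 0 with h | h
    · simp only [max_eq_right h, max_eq_left (neg_nonneg.mpr h)]
      constructor <;> linarith
    · simp only [max_eq_left h, max_eq_right (neg_nonpos.mpr h)]
      constructor <;> linarith
  set S : H →L[ℂ] H := 1 - 2 * P with hS
  have hSS : S * S = 1 := by
    have := hP.isIdempotentElem.eq
    calc S * S = 1 - 4 * P + 4 * (P * P) := by rw [hS]; noncomm_ring
      _ = 1 := by rw [this]; noncomm_ring
  have hSsa : star S = S := by
    have h2 : S = 1 - (P + P) := by rw [hS, two_mul]
    rw [h2]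
    simp [hP.isSelfAdjoint.star_eq]
  have hSnorm : ‖S‖ ≤ 1 := by
    have h1 : ‖S‖ * ‖S‖ ≤ 1 := by
      rw [← CStarRing.norm_star_mul_self, hSsa, hSS]
      exact ContinuousLinearMap.norm_id_le
    nlinarith [norm_nonneg S]
  have hfac : T - (r / 2) • S = S * (F + G - (r / 2) • 1) := by
    have : S * (F + G) = T := by
      calc S * (F + G) = F + G - 2 * (P * F) - 2 * (P * G) := by rw [hS]; noncomm_ring
        _ = T := by rw [hPF, hPG, hT_eq]; noncomm_ring
    rw [mul_sub, this, mul_smul_comm, mul_one]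
  refine ⟨P, hPN, hP, ?_⟩
  rw [hfac]
  calc _ ≤ ‖S‖ * ‖F + G - (r / 2) • (1 : H →L[ℂ] H)‖ := norm_mul_le _ _
    _ ≤ 1 * (r / 2) := by gcongr
    _ = r / 2 := one_mul _

/-- A continuous functional vanishing on the projections of a von Neumann algebra vanishes on
the whole algebra. -/
theorem eq_zero_of_forall_isStarProjection (N : VonNeumannAlgebra H)
    (ψ : (H →L[ℂ] H) →L[ℂ] ℂ) (hψ : ∀ P ∈ N, IsStarProjection P → ψ P = 0)
    {T : H →L[ℂ] H} (hT : T ∈ N) : ψ T = 0 := by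
  have hsa : ∀ T ∈ N, IsSelfAdjoint T → ψ T = 0 := by
    intro T hT hTsa
    have approx (n : ℕ) :
        ∃ R ∈ N, IsSelfAdjoint R ∧ ‖R‖ ≤ ‖T‖ * (1 / 2) ^ n ∧ ψ R = ψ T := by
      induction n with
      | zero => exact ⟨T, hT, hTsa, by simp, rfl⟩
      | succ n ih =>
        obtain ⟨R, hR, hRsa, hRn, hRψ⟩ := ih
        obtain ⟨P, hPN, hP, hle⟩ := N.exists_isStarProjection_norm_sub_le hR hRsa hRn
        rw [two_mul] at hle
        refine ⟨_, sub_mem hR (N.real_smul_mem _ (sub_mem (one_mem N) (add_mem hPN hPN))),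
          hRsa.sub (.smul (.all _) (.sub (.one _) (hP.isSelfAdjoint.add hP.isSelfAdjoint))),
          hle.trans_eq (by ring), ?_⟩
        rw [← Complex.coe_smul]
        simp [hψ P hPN hP, hψ 1 (one_mem N) (.one _), hRψ]
    refine norm_le_zero_iff.mp (ge_of_tendsto' (x := Filter.atTop)
      (f := fun n : ℕ ↦ ‖ψ‖ * (‖T‖ * (1 / 2) ^ n)) ?_ fun n ↦ ?_)
    · simpa using ((tendsto_pow_atTop_nhds_zero_of_lt_one (r := (1 / 2 : ℝ)) (by norm_num)
        (by norm_num)).const_mul ‖T‖).const_mul ‖ψ‖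
    · obtain ⟨R, -, -, hRn, hRψ⟩ := approx n
      rw [← hRψ]
      exact (ψ.le_opNorm R).trans (by gcongr)
  have hre : ((realPart T : selfAdjoint (H →L[ℂ] H)) : H →L[ℂ] H) ∈ N := by
    rw [realPart_apply_coe]
    exact N.real_smul_mem _ (add_mem hT (star_mem hT))
  have him : ((imaginaryPart T : selfAdjoint (H →L[ℂ] H)) : H →L[ℂ] H) ∈ N := by
    rw [imaginaryPart_apply_coe]
    exact N.smul_mem _ (N.real_smul_mem _ (sub_mem hT (star_mem hT)))
  rw [← realPart_add_I_smul_imaginaryPart T]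
  simp [hsa _ hre (realPart T).2, hsa _ him (imaginaryPart T).2]

end VonNeumannAlgebra

/-- Positive functionals on bounded operators are continuous. -/
theorem continuous_of_forall_star_mul_self_nonneg (φ : (H →L[ℂ] H) →ₗ[ℂ] ℂ)
    (hpos : ∀ a : H →L[ℂ] H, 0 ≤ φ (star a * a)) : Continuous φ := by
  have h0 (a : H →L[ℂ] H) (ha : 0 ≤ a) : 0 ≤ φ a := by
    obtain ⟨b, rfl⟩ := CStarAlgebra.nonneg_iff_eq_star_mul_self.mp ha
    exact hpos b
  exact map_continuous (PositiveLinearMap.mk₀ φ h0)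

/-- A continuous functional which factorises over products of projections from two von Neumann
algebras factorises over all products. -/
theorem map_mul_of_forall_isStarProjection (N₁ N₂ : VonNeumannAlgebra H)
    (φ : (H →L[ℂ] H) →L[ℂ] ℂ)
    (h : ∀ A ∈ N₁, ∀ B ∈ N₂, IsStarProjection A → IsStarProjection B →
      φ (A * B) = φ A * φ B)
    {X Y : H →L[ℂ] H} (hX : X ∈ N₁) (hY : Y ∈ N₂) : φ (X * Y) = φ X * φ Y := by
  have hleft (B : H →L[ℂ] H) (hB : B ∈ N₂) (hBP : IsStarProjection B) :
      φ (X * B) = φ X * φ B := by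
    have := N₁.eq_zero_of_forall_isStarProjection
      (φ.comp ((ContinuousLinearMap.mul ℂ (H →L[ℂ] H)).flip B) - φ B • φ)
      (fun P hP hPP ↦ by simp [h P hP B hB hPP hBP, mul_comm]) hX
    simpa [sub_eq_zero, mul_comm] using this
  have := N₂.eq_zero_of_forall_isStarProjection
    (φ.comp (ContinuousLinearMap.mul ℂ (H →L[ℂ] H) X) - φ X • φ)
    (fun P hP hPP ↦ by simp [hleft P hP hPP]) hY
  simpa [sub_eq_zero] using this

end ProjectionsInVonNeumannAlgebra

open scoped ComplexOrder

/-- Lemma 2 (nonproduct): a normal state that is not a product state across commuting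
von Neumann subalgebras correlates some pair of projections. (Normality of the state is
not needed for the statement; any state, i.e. positive unital linear functional, works.) -/
theorem stmt_9 {H : Type*} [NormedAddCommGroup H] [InnerProductSpace ℂ H] [CompleteSpace H]
    (N₁ N₂ : VonNeumannAlgebra H)
    (hcomm : ∀ x ∈ N₁, ∀ y ∈ N₂, Commute x y)
    (φ : (H →L[ℂ] H) →ₗ[ℂ] ℂ)
    (hpos : ∀ a : H →L[ℂ] H, 0 ≤ φ (star a * a)) (hone : φ 1 = 1)
    (hnonprod : ∃ X ∈ N₁, ∃ Y ∈ N₂, φ (X * Y) ≠ φ X * φ Y) :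
    ∃ A ∈ N₁, ∃ B ∈ N₂, IsSelfAdjoint A ∧ IsIdempotentElem A ∧
      IsSelfAdjoint B ∧ IsIdempotentElem B ∧ φ A * φ B < φ (A * B) := by
  have hproj (P : H →L[ℂ] H) (hP : IsStarProjection P) : 0 ≤ φ P := by
    simpa [hP.isSelfAdjoint.star_eq, hP.isIdempotentElem.eq] using hpos P
  by_contra! hcon
  obtain ⟨X, hX, Y, hY, hne⟩ := hnonprod
  refine hne (map_mul_of_forall_isStarProjection N₁ N₂
    ⟨φ, continuous_of_forall_star_mul_self_nonneg φ hpos⟩ ?_ hX hY)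
  intro A hA B hB hAP hBP
  have hAB : IsStarProjection (A * B) := hAP.mul hBP (hcomm A hA B hB)
  have h1 := hcon A hA B hB hAP.isSelfAdjoint hAP.isIdempotentElem
    hBP.isSelfAdjoint hBP.isIdempotentElem
  have h2 := hcon A hA (1 - B) (sub_mem (one_mem N₂) hB) hAP.isSelfAdjoint hAP.isIdempotentElem
    hBP.one_sub.isSelfAdjoint hBP.one_sub.isIdempotentElem
  rw [mul_sub, mul_one, map_sub, map_sub, hone] at h2
  change φ (A * B) = φ A * φ B
  have hA0 := hproj A hAP
  have hB0 := hproj B hBP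
  have hAB0 := hproj _ hAB
  obtain ⟨a, ha⟩ : ∃ a : ℝ, φ A = a := ⟨_, Complex.eq_re_of_ofReal_le hA0⟩
  obtain ⟨b, hb⟩ : ∃ b : ℝ, φ B = b := ⟨_, Complex.eq_re_of_ofReal_le hB0⟩
  obtain ⟨c, hc⟩ : ∃ c : ℝ, φ (A * B) = c := ⟨_, Complex.eq_re_of_ofReal_le hAB0⟩
  rw [ha, hb, hc] at h1 h2 ⊢
  norm_cast at h1 h2 ⊢
  linarith
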